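/- Let U < ∞ and let the potential outcomes take values in the cube: Y(0), Y(1) : Ω → [−U, U]^p, with realized outcome Y := D·Y(1) + (1 − D)·Y(0). Let 𝒴_ε ⊂ [−U, U]^p be a finite grid with associated pairwise disjoint measurable bins {B_y : y ∈ 𝒴_ε} that cover [−U, U]^p and satisfy B_y ⊆ {y' : ‖y' − y‖_∞ ≤ ε} for each y, and let Ỹ be the discretized outcome equal to y on {Y ∈ B_y}. Fix x ∈ 𝒳 with P(X = x) > 0 and suppose: (Randomization) under P(·|S = e, X = x), D is independent of the pair (Y(0), Y(1)); (Positivity) P(S = e, X = x, D = d, Y ∈ B_y) > 0 and P(S = o, X = x, Y ∈ B_y) > 0 for all d ∈ {0, 1}, y ∈ 𝒴_ε; (Stability) R is conditionally independent of S given (X, D, Ỹ); (No direct effect) R is conditionally independent of D given (X, Ỹ). Then for each d ∈ {0, 1}, P_x-almost surely under P_x := P(·|X = x): E_{P_x}[1{D = d, S = e} | σ(R)] / P(D = d, S = e | X = x) = Σ_{y ∈ 𝒴_ε} ( E_{P_x}[1{Y ∈ B_y, S = o} | σ(R)] / P(Y ∈ B_y, S = o | X = x) ) · P(Y(d) ∈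 B_y | S = e, X = x). -/

import Mathlib

open MeasureTheory ProbabilityTheory

noncomputable section

/-- Sample indicator values: experimental (`e`) or observational (`o`). -/
inductive Sample : Type
  | e
  | o
deriving DecidableEq

instance : MeasurableSpace Sample := ⊤

/-- Real-valued indicator of a boolean (`{0,1}`-valued variable). -/
def b2r (b : Bool) : ℝ := if b then 1 else 0

/-- `CondIndepOf P R V W` : the conditional law of `R` given `V = v, W = w` agrees with
the conditional law of `R` given `V = v`, for all values with positive probability;
this is the notion of "R is conditionally independent of W given V" for variables with
countable ranges. -/
def CondIndepOf {Ω 𝓡 V W : Type*} [MeasurableSpace Ω] [MeasurableSpace 𝓡]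
    (P : Measure Ω) (R : Ω → 𝓡) (Vf : Ω → V) (Wf : Ω → W) : Prop :=
  ∀ v w, 0 < P {ω | Vf ω = v ∧ Wf ω = w} →
    (P[|{ω | Vf ω = v ∧ Wf ω = w}]).map R = (P[|{ω | Vf ω = v}]).map R

theorem measureReal_cond_apply {Ω : Type*} [MeasurableSpace Ω] {s : Set Ω} (hs : MeasurableSet s)
    (μ : Measure Ω) (t : Set Ω) : (μ[|s]).real t = (μ.real s)⁻¹ * μ.real (s ∩ t) := by
  simp only [measureReal_def, cond_apply hs, ENNReal.toReal_mul, ENNReal.toReal_inv]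

/-- A linear relation between the restrictions of `μ` to finitely many events that holds on the
sub-σ-algebra `m` is inherited by the conditional probabilities given `m`. -/
theorem condExp_indicator_div_ae_eq_sum {Ω ι : Type*} [Fintype ι] {m m0 : MeasurableSpace Ω}
    (hm : m ≤ m0) (μ : Measure[m0] Ω) [IsFiniteMeasure μ] {E : Set Ω} {F : ι → Set Ω}
    (hE : MeasurableSet[m0] E) (hF : ∀ i, MeasurableSet[m0] (F i)) (c : ℝ) (f w : ι → ℝ)
    (h : ∀ s, MeasurableSet[m] s →
      μ.real (s ∩ E) / c = ∑ i, μ.real (s ∩ F i) / f i * w i) :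
    (fun ω => (μ[E.indicator fun _ => (1 : ℝ) | m]) ω / c) =ᵐ[μ]
      fun ω => ∑ i, (μ[(F i).indicator fun _ => (1 : ℝ) | m]) ω / f i * w i := by
  have hset : ∀ {G s : Set Ω}, MeasurableSet[m0] G → MeasurableSet[m] s →
      ∫ ω in s, (μ[G.indicator fun _ => (1 : ℝ) | m]) ω ∂μ = μ.real (s ∩ G) := by
    intro G s hG hs
    rw [setIntegral_condExp hm ((integrable_const 1).indicator hG) hs,
      setIntegral_indicator hG]
    simp
  have hint : ∀ i, Integrable
      (fun ω => (μ[(F i).indicator fun _ => (1 : ℝ) | m]) ω / f i * w i) μ :=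
    fun i => (integrable_condExp.div_const _).mul_const _
  refine ae_eq_of_forall_setIntegral_eq_of_sigmaFinite' hm
    (fun s _ _ => (integrable_condExp.div_const _).integrableOn)
    (fun s _ _ => (integrable_finsetSum _ fun i _ => hint i).integrableOn) ?_ ?_ ?_
  · intro s hs _
    rw [integral_div, hset hE hs, integral_finsetSum _ fun i _ => (hint i).integrableOn, h s hs]
    refine Finset.sum_congr rfl fun i _ => ?_
    rw [integral_mul_const, integral_div, hset (hF i) hs]
  · exact (stronglyMeasurable_condExp.div stronglyMeasurable_const).aestronglyMeasurable
  · exact (Finset.stronglyMeasurable_fun_sum _ fun i _ =>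
      (stronglyMeasurable_condExp.div stronglyMeasurable_const).mul
        stronglyMeasurable_const).aestronglyMeasurable

/-- Conditional independence as a product formula, valid also on null cells. -/
theorem CondIndepOf.measureReal_inter_preimage {Ω 𝓡 V W : Type*} [MeasurableSpace Ω]
    [MeasurableSpace 𝓡] {P : Measure Ω} [IsFiniteMeasure P] {R : Ω → 𝓡} {Vf : Ω → V} {Wf : Ω → W}
    (h : CondIndepOf P R Vf Wf) (hR : Measurable R) {v : V} {w : W}
    (hVW : MeasurableSet {ω | Vf ω = v ∧ Wf ω = w}) {A : Set 𝓡} (hA : MeasurableSet A) :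
    P.real ({ω | Vf ω = v ∧ Wf ω = w} ∩ R ⁻¹' A) =
      P.real {ω | Vf ω = v ∧ Wf ω = w} * (P[|{ω | Vf ω = v}]).real (R ⁻¹' A) := by
  rcases eq_zero_or_pos (P {ω | Vf ω = v ∧ Wf ω = w}) with h0 | h0
  · simp [Measure.real, h0, measure_mono_null Set.inter_subset_left h0]
  · have h1 := congrArg (fun ν => ν A) (h v w h0)
    simp only [Measure.map_apply hR hA] at h1
    rw [Measure.real, Measure.real, Measure.real, ← h1, ← ENNReal.toReal_mul, mul_comm,
      cond_mul_eq_inter hVW]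

/-- Stability together with no direct effect: on each cell of treatment, outcome and sample, the
law of `R` depends only on the covariate and the outcome. -/
theorem measureReal_cell_inter_preimage {Ω 𝓡 𝓧 𝓓 𝓢 ι : Type*} [MeasurableSpace Ω]
    [MeasurableSpace 𝓡] {P : Measure Ω} [IsFiniteMeasure P]
    {R : Ω → 𝓡} {X : Ω → 𝓧} {D : Ω → 𝓓} {S : Ω → 𝓢} {Z : Ω → ι} (hR : Measurable R)
    (stability : CondIndepOf P R (fun ω => (X ω, D ω, Z ω)) S)
    (noDirectEffect : CondIndepOf P R (fun ω => (X ω, Z ω)) D)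
    {x : 𝓧} {d : 𝓓} {s : 𝓢} {i : ι} (hx : MeasurableSet (X ⁻¹' {x}))
    (hd : MeasurableSet (D ⁻¹' {d})) (hs : MeasurableSet (S ⁻¹' {s}))
    (hi : MeasurableSet (Z ⁻¹' {i})) {A : Set 𝓡} (hA : MeasurableSet A) :
    P.real ({ω | X ω = x ∧ D ω = d ∧ Z ω = i ∧ S ω = s} ∩ R ⁻¹' A) =
      P.real {ω | X ω = x ∧ D ω = d ∧ Z ω = i ∧ S ω = s} *
        (P[|{ω | (X ω, Z ω) = (x, i)}]).real (R ⁻¹' A) := by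
  have e1 : {ω | X ω = x ∧ D ω = d ∧ Z ω = i ∧ S ω = s} =
      {ω | (X ω, D ω, Z ω) = (x, d, i) ∧ S ω = s} := by
    ext; simp [and_assoc]
  have e2 : {ω | (X ω, Z ω) = (x, i) ∧ D ω = d} = {ω | (X ω, D ω, Z ω) = (x, d, i)} := by
    ext; simp; tauto
  have m2 : MeasurableSet {ω | (X ω, D ω, Z ω) = (x, d, i)} := by
    convert hx.inter (hd.inter hi) using 1
    ext; simp
  have h1 := stability.measureReal_inter_preimage hR (v := (x, d, i)) (w := s) (m2.inter hs) hA
  have h2 := noDirectEffect.measureReal_inter_preimage hR (v := (x, i)) (w := d)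
    (e2 ▸ m2) hA
  rw [e1, h1]
  rw [e2] at h2
  rcases eq_or_ne (P.real {ω | (X ω, D ω, Z ω) = (x, d, i)}) 0 with h0 | h0
  · have : P.real {ω | (X ω, D ω, Z ω) = (x, d, i) ∧ S ω = s} = 0 :=
      measureReal_mono_null (fun _ h => h.1) h0
    rw [this, zero_mul, zero_mul]
  · rw [measureReal_cond_apply m2, h2, inv_mul_cancel_left₀ h0]

/-- Under randomization within the conditioning event `C`, the cell `{D = d, Z ∈ B}` factorizes. -/
theorem measureReal_inter_eq_mul_of_indepFun_cond {Ω 𝓓 𝓩 : Type*} [MeasurableSpace Ω]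
    [MeasurableSpace 𝓓] [MeasurableSpace 𝓩] {P : Measure Ω} [IsFiniteMeasure P] {C : Set Ω}
    (hC : MeasurableSet C) {D : Ω → 𝓓} {Z : Ω → 𝓩} (h : IndepFun D Z P[|C]) {T : Set 𝓓}
    {B : Set 𝓩} (hT : MeasurableSet T) (hB : MeasurableSet B) :
    P.real (C ∩ (D ⁻¹' T ∩ Z ⁻¹' B)) = P.real (C ∩ D ⁻¹' T) * (P[|C]).real (Z ⁻¹' B) := by
  have h1 := h.measure_inter_preimage_eq_mul T B hT hB
  simp only [Measure.real, ← ENNReal.toReal_mul]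
  rw [← cond_mul_eq_inter hC, h1, ← cond_mul_eq_inter hC]
  ring_nf

/-- **Proposition (Binning / discretized identification for continuous outcomes).**
With outcomes in `[−U, U]^p` discretized over a finite grid of disjoint bins of
sup-norm radius `ε`, the treatment weights equal the bin-outcome-weighted mixture,
`P_x`-a.s. -/
theorem statement13
    {Ω 𝓡 𝓧 : Type*} [MeasurableSpace Ω] [MeasurableSpace 𝓡] [StandardBorelSpace 𝓡]
    [MeasurableSpace 𝓧] [MeasurableSingletonClass 𝓧] [Countable 𝓧]
    (P : Measure Ω) [IsProbabilityMeasure P]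
    (p : ℕ) (U ε : ℝ)
    (S : Ω → Sample) (D : Ω → Bool) (Y0 Y1 : Ω → (Fin p → ℝ)) (R : Ω → 𝓡) (X : Ω → 𝓧)
    (hS : Measurable S) (hD : Measurable D) (hY0 : Measurable Y0) (hY1 : Measurable Y1)
    (hR : Measurable R) (hX : Measurable X)
    -- Potential outcomes take values in the cube [−U, U]^p
    (hY0bd : ∀ ω j, |Y0 ω j| ≤ U) (hY1bd : ∀ ω j, |Y1 ω j| ≤ U)
    (Y : Ω → (Fin p → ℝ)) (hYdef : ∀ ω, Y ω = if D ω then Y1 ω else Y0 ω)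
    -- The grid 𝒴_ε and its bins
    {ι : Type*} [Fintype ι]
    (grid : ι → (Fin p → ℝ)) (hgrid : ∀ i j, |grid i j| ≤ U)
    (Bset : ι → Set (Fin p → ℝ))
    (hBmeas : ∀ i, MeasurableSet (Bset i))
    (hBdisj : Pairwise (Function.onFun Disjoint Bset))
    (hBcover : ∀ v : Fin p → ℝ, (∀ j, |v j| ≤ U) → ∃ i, v ∈ Bset i)
    (hBrad : ∀ i, Bset i ⊆ {v | ‖v - grid i‖ ≤ ε})
    -- The discretized outcome Ỹ, equal to (the index of) y on {Y ∈ B_y}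
    (Ytil : Ω → ι) (hYtil : ∀ ω i, Y ω ∈ Bset i → Ytil ω = i)
    (x : 𝓧) (hx : 0 < P {ω | X ω = x})
    -- Randomization: D ⫫ (Y(0), Y(1)) under P(·|S = e, X = x)
    (randomization :
      IndepFun D (fun ω => (Y0 ω, Y1 ω)) (P[|{ω | S ω = Sample.e ∧ X ω = x}]))
    -- Positivity
    (positivity_e : ∀ (d : Bool) (i : ι),
      0 < P {ω | S ω = Sample.e ∧ X ω = x ∧ D ω = d ∧ Y ω ∈ Bset i})
    (positivity_o : ∀ i : ι,
      0 < P {ω | S ω = Sample.o ∧ X ω = x ∧ Y ω ∈ Bset i})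
    -- Stability: R ⫫ S | (X, D, Ỹ)
    (stability : CondIndepOf P R (fun ω => (X ω, D ω, Ytil ω)) S)
    -- No direct effect: R ⫫ D | (X, Ỹ)
    (noDirectEffect : CondIndepOf P R (fun ω => (X ω, Ytil ω)) D)
    (d : Bool) :
    ∀ᵐ ω ∂(P[|{ω' | X ω' = x}]),
      ((P[|{ω' | X ω' = x}])[({ω' | D ω' = d ∧ S ω' = Sample.e}.indicator
            fun _ => (1 : ℝ)) |
          MeasurableSpace.comap R inferInstance]) ω /
        ((P[|{ω' | X ω' = x}]) {ω' | D ω' = d ∧ S ω' = Sample.e}).toReal =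
      ∑ i : ι,
        (((P[|{ω' | X ω' = x}])[({ω' | Y ω' ∈ Bset i ∧ S ω' = Sample.o}.indicator
              fun _ => (1 : ℝ)) |
            MeasurableSpace.comap R inferInstance]) ω /
          ((P[|{ω' | X ω' = x}]) {ω' | Y ω' ∈ Bset i ∧ S ω' = Sample.o}).toReal) *
        ((P[|{ω' | S ω' = Sample.e ∧ X ω' = x}])
          {ω' | (if d then Y1 ω' else Y0 ω') ∈ Bset i}).toReal := by
  have hYm : Measurable Y := by
    have : Y = fun ω => if D ω = true then Y1 ω else Y0 ω := funext hYdef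
    rw [this]
    exact Measurable.ite (hD (measurableSet_singleton true)) hY1 hY0
  have hYbd : ∀ ω j, |Y ω j| ≤ U := by
    intro ω j
    rw [hYdef]
    split_ifs
    exacts [hY1bd ω j, hY0bd ω j]
  have hbin : ∀ ω i, Y ω ∈ Bset i ↔ Ytil ω = i := by
    refine fun ω i => ⟨hYtil ω i, fun h => ?_⟩
    obtain ⟨j, hj⟩ := hBcover _ (hYbd ω)
    rwa [← h, hYtil ω j hj]
  have mX : MeasurableSet (X ⁻¹' {x}) := hX (measurableSet_singleton x)
  have mD : ∀ b, MeasurableSet (D ⁻¹' {b}) := fun b => hD (measurableSet_singleton b)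
  have mS : ∀ s, MeasurableSet (S ⁻¹' {s}) := fun s => hS trivial
  have mZ : ∀ i, MeasurableSet (Ytil ⁻¹' {i}) := by
    intro i
    convert hYm (hBmeas i) using 1
    ext ω
    exact (hbin ω i).symm
  have mXe : MeasurableSet {ω | X ω = x} := mX
  have mC : MeasurableSet {ω | S ω = Sample.e ∧ X ω = x} := (mS _).inter mX
  have hx0 : P.real {ω | X ω = x} ≠ 0 := (ENNReal.toReal_pos hx.ne' (measure_ne_top _ _)).ne'
  have hcell := fun b s i (A : Set 𝓡) (hA : MeasurableSet A) =>
    measureReal_cell_inter_preimage hR stability noDirectEffect mX (mD b) (mS s) (mZ i) hA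
  have hw : ∀ i, P.real {ω | X ω = x ∧ D ω = d ∧ Ytil ω = i ∧ S ω = Sample.e} =
      P.real {ω | X ω = x ∧ D ω = d ∧ S ω = Sample.e} *
        (P[|{ω' | S ω' = Sample.e ∧ X ω' = x}]).real
          {ω' | (if d then Y1 ω' else Y0 ω') ∈ Bset i} := by
    intro i
    have mB : MeasurableSet {q : (Fin p → ℝ) × (Fin p → ℝ) |
        (if d then q.2 else q.1) ∈ Bset i} := by
      cases d
      exacts [measurable_fst (hBmeas i), measurable_snd (hBmeas i)]
    convert measureReal_inter_eq_mul_of_indepFun_cond mC randomization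
      (measurableSet_singleton d) mB using 2
    · ext ω
      simp only [Set.mem_ofPred_eq, Set.mem_inter_iff, Set.mem_preimage, Set.mem_singleton_iff,
        ← hbin, hYdef]
      constructor
      · rintro ⟨h1, rfl, h3, h4⟩
        exact ⟨⟨h4, h1⟩, rfl, h3⟩
      · rintro ⟨⟨h4, h1⟩, rfl, h3⟩
        exact ⟨h1, rfl, h3, h4⟩
    · congr 1
      ext ω
      simp only [Set.mem_ofPred_eq, Set.mem_inter_iff, Set.mem_preimage, Set.mem_singleton_iff]
      tauto
    · rfl
  have hE : ∀ A : Set 𝓡, MeasurableSet A →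
      P.real ({ω | X ω = x} ∩ (R ⁻¹' A ∩ {ω | D ω = d ∧ S ω = Sample.e})) =
        ∑ i, P.real {ω | X ω = x ∧ D ω = d ∧ Ytil ω = i ∧ S ω = Sample.e} *
          (P[|{ω | (X ω, Ytil ω) = (x, i)}]).real (R ⁻¹' A) := by
    intro A hA
    have hU : {ω | X ω = x} ∩ (R ⁻¹' A ∩ {ω | D ω = d ∧ S ω = Sample.e}) =
        ⋃ i, ({ω | X ω = x ∧ D ω = d ∧ Ytil ω = i ∧ S ω = Sample.e} ∩ R ⁻¹' A) := by
      ext ω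
      simp
      tauto
    rw [hU, measureReal_iUnion_fintype]
    · exact Finset.sum_congr rfl fun i _ => hcell d _ i A hA
    · intro i j hij
      refine Set.disjoint_left.2 fun ω h1 h2 => hij ?_
      rw [← h1.1.2.2.1, ← h2.1.2.2.1]
    · exact fun i => (mX.inter ((mD d).inter ((mZ i).inter (mS _)))).inter (hR hA)
  have hF : ∀ (i : ι) (A : Set 𝓡), MeasurableSet A →
      P.real ({ω | X ω = x} ∩ (R ⁻¹' A ∩ {ω | Y ω ∈ Bset i ∧ S ω = Sample.o})) =
        P.real ({ω | X ω = x} ∩ {ω | Y ω ∈ Bset i ∧ S ω = Sample.o}) *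
          (P[|{ω | (X ω, Ytil ω) = (x, i)}]).real (R ⁻¹' A) := by
    intro i
    have hsum : ∀ A : Set 𝓡, MeasurableSet A →
        P.real ({ω | X ω = x} ∩ (R ⁻¹' A ∩ {ω | Y ω ∈ Bset i ∧ S ω = Sample.o})) =
          ∑ b, P.real ({ω | X ω = x ∧ D ω = b ∧ Ytil ω = i ∧ S ω = Sample.o} ∩ R ⁻¹' A) := by
      intro A hA
      have hU : {ω | X ω = x} ∩ (R ⁻¹' A ∩ {ω | Y ω ∈ Bset i ∧ S ω = Sample.o}) =
          ⋃ b, ({ω | X ω = x ∧ D ω = b ∧ Ytil ω = i ∧ S ω = Sample.o} ∩ R ⁻¹' A) := by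
        ext ω
        simp only [hbin, Set.mem_inter_iff, Set.mem_ofPred_eq, Set.mem_iUnion, Set.mem_preimage,
          exists_and_right, exists_and_left]
        tauto
      rw [hU, measureReal_iUnion_fintype]
      · intro b c hbc
        refine Set.disjoint_left.2 fun ω h1 h2 => hbc ?_
        rw [← h1.1.2.1, ← h2.1.2.1]
      · exact fun b => (mX.inter ((mD b).inter ((mZ i).inter (mS _)))).inter (hR hA)
    intro A hA
    have hall := hsum Set.univ MeasurableSet.univ
    simp only [Set.preimage_univ, Set.univ_inter, Set.inter_univ] at hall
    rw [hsum A hA, hall, Finset.sum_mul]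
    exact Finset.sum_congr rfl fun b _ => hcell b _ i A hA
  obtain ⟨ω₀, -⟩ := nonempty_of_measure_ne_zero hx.ne'
  have hc0 : P.real {ω | X ω = x ∧ D ω = d ∧ S ω = Sample.e} ≠ 0 := by
    refine (ENNReal.toReal_pos ((positivity_e d (Ytil ω₀)).trans_le
      (measure_mono ?_)).ne' (measure_ne_top _ _)).ne'
    exact fun ω h => ⟨h.2.1, h.2.2.1, h.1⟩
  have hf0 : ∀ i, P.real ({ω | X ω = x} ∩ {ω | Y ω ∈ Bset i ∧ S ω = Sample.o}) ≠ 0 := by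
    intro i
    refine (ENNReal.toReal_pos ((positivity_o i).trans_le
      (measure_mono ?_)).ne' (measure_ne_top _ _)).ne'
    exact fun ω h => ⟨h.2.1, h.2.2, h.1⟩
  refine condExp_indicator_div_ae_eq_sum hR.comap_le _
    (E := {ω | D ω = d ∧ S ω = Sample.e}) (F := fun i => {ω | Y ω ∈ Bset i ∧ S ω = Sample.o})
    ((mD d).inter (mS _)) (fun i => (hYm (hBmeas i)).inter (mS _)) _ _ _ ?_
  rintro _ ⟨A, hA, rfl⟩
  simp only [← measureReal_def, measureReal_cond_apply mXe]
  rw [hE A hA, mul_div_mul_left _ _ (inv_ne_zero hx0), Finset.sum_div]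
  refine Finset.sum_congr rfl fun i _ => ?_
  have hc : {ω | X ω = x} ∩ {ω | D ω = d ∧ S ω = Sample.e} =
      {ω | X ω = x ∧ D ω = d ∧ S ω = Sample.e} := rfl
  rw [mul_div_mul_left _ _ (inv_ne_zero hx0), hF i A hA, mul_div_cancel_left₀ _ (hf0 i), hw i,
    hc, mul_assoc, mul_div_cancel_left₀ _ hc0, mul_comm]
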